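/- For every α > 0 and x₀ > 0 there exist θ₂ > 0 and C > 0 such that for all 0 < θ < θ₂: M_{x₀} < 2, B ≠ 0, and |R − R_{x₀} − (2i)^(−1) b(x₀) b'(x₀) e^(−2iφ(x₀)) − ∫_0^{x₀} (b'(y)/b(y)) e^(−2iφ(y)) dy| ≤ C θ². -/

import Mathlib

open MeasureTheory Set Filter Topology

noncomputable section

/-- The wave speed profile `c(x) = (1 + θ (x₊)^α)^(-1/2)`. -/
def spd (α θ x : ℝ) : ℝ := (1 + θ * (max x 0) ^ α) ^ (-(1 / 2) : ℝ)

/-- The WKB amplitude `b(x) = c(x)^(1/2)`. -/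
def amp (α θ x : ℝ) : ℝ := spd α θ x ^ ((1 : ℝ) / 2)

/-- The WKB phase `φ(x) = ∫₀ˣ c(y)⁻¹ dy`. -/
def phase (α θ x : ℝ) : ℝ := ∫ y in (0:ℝ)..x, (spd α θ y)⁻¹

/-- `M(x) = c(x)^(1/2) (c^(1/2))''(x)` for `x > 0`, and `0` for `x ≤ 0`. -/
def Mfun (α θ x : ℝ) : ℝ :=
  if 0 < x then
    spd α θ x ^ ((1 : ℝ) / 2) * deriv (deriv (fun y => spd α θ y ^ ((1 : ℝ) / 2))) x
  else 0

/-- `M_{x₀} = ∫_{x₀}^∞ |M(x)| dx`. -/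
def Mtail (α θ x₀ : ℝ) : ℝ := ∫ x in Ioi x₀, |Mfun α θ x|

/-- The Volterra operator `K_σ`. -/
def Kop (α θ x₀ σ : ℝ) (f : ℝ → ℂ) (x : ℝ) : ℂ :=
  (2 * Complex.I * (1 + Complex.I * (σ : ℂ)))⁻¹ *
    ((∫ y in x₀..x, (Mfun α θ y : ℂ) * f y *
        Complex.exp (-2 * Complex.I * (1 + Complex.I * (σ : ℂ)) *
          ((phase α θ x - phase α θ y : ℝ) : ℂ))) +
      ∫ y in Ioi x, (Mfun α θ y : ℂ) * f y)

/-- The right-going WKB wave `v^> = b e^{-iφ}`. -/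
def vplus (α θ x : ℝ) : ℂ := (amp α θ x : ℂ) * Complex.exp (-Complex.I * (phase α θ x : ℂ))

/-- The left-going WKB wave `v^< = b e^{iφ}`. -/
def vminus (α θ x : ℝ) : ℂ := (amp α θ x : ℂ) * Complex.exp (Complex.I * (phase α θ x : ℂ))

/-- `S` is a bounded continuous solution on `[x₀,∞)` of `S = e^{-2iφ} + K₀ S`. -/
def IsVolterraSol (α θ x₀ : ℝ) (S : ℝ → ℂ) : Prop :=
  (∃ C, ∀ x ∈ Ici x₀, ‖S x‖ ≤ C) ∧ ContinuousOn S (Ici x₀) ∧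
    ∀ x ∈ Ici x₀, S x = Complex.exp (-2 * Complex.I * (phase α θ x : ℂ)) + Kop α θ x₀ 0 S x

/-- `R_{x₀} = (2i)⁻¹ ∫_{x₀}^∞ M S^>`. -/
def Rx (α θ x₀ : ℝ) (S : ℝ → ℂ) : ℂ :=
  (2 * Complex.I)⁻¹ * ∫ x in Ioi x₀, (Mfun α θ x : ℂ) * S x

/-- The profile `1 + θ x₊^α` under the square root is at least one. -/
lemma one_le_profile {α θ : ℝ} (hθ : 0 < θ) (x : ℝ) : 1 ≤ 1 + θ * (max x 0) ^ α := by
  have : 0 ≤ (max x 0) ^ α := Real.rpow_nonneg (le_max_right _ _) _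
  nlinarith [mul_nonneg hθ.le this]

lemma spd_pos {α θ : ℝ} (hθ : 0 < θ) (x : ℝ) : 0 < spd α θ x :=
  Real.rpow_pos_of_pos (lt_of_lt_of_le one_pos (one_le_profile hθ x)) _

lemma spd_le_one {α θ : ℝ} (hθ : 0 < θ) (x : ℝ) : spd α θ x ≤ 1 :=
  Real.rpow_le_one_of_one_le_of_nonpos (one_le_profile hθ x) (by norm_num)

lemma spd_sq {α θ : ℝ} (hθ : 0 < θ) (x : ℝ) :
    spd α θ x ^ 2 = (1 + θ * (max x 0) ^ α)⁻¹ := by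
  have h := one_le_profile (α := α) hθ x
  rw [spd, ← Real.rpow_natCast, ← Real.rpow_mul (by linarith), ← Real.rpow_neg_one]
  norm_num

lemma amp_pos {α θ : ℝ} (hθ : 0 < θ) (x : ℝ) : 0 < amp α θ x :=
  Real.rpow_pos_of_pos (spd_pos hθ x) _

lemma amp_sq {α θ : ℝ} (hθ : 0 < θ) (x : ℝ) : amp α θ x ^ 2 = spd α θ x := by
  rw [amp, ← Real.rpow_natCast, ← Real.rpow_mul (spd_pos hθ x).le]
  norm_num

lemma continuous_spd {α θ : ℝ} (hα : 0 < α) (hθ : 0 < θ) : Continuous (spd α θ) := by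
  unfold spd
  refine Continuous.rpow_const (continuous_const.add (continuous_const.mul
    ((continuous_id.max continuous_const).rpow_const fun _ => Or.inr hα.le))) fun x => Or.inl ?_
  exact (lt_of_lt_of_le one_pos (one_le_profile hθ x)).ne'

lemma continuous_amp {α θ : ℝ} (hα : 0 < α) (hθ : 0 < θ) : Continuous (amp α θ) :=
  (continuous_spd hα hθ).rpow_const fun x => Or.inl (spd_pos hθ x).ne'

lemma one_sub_spd_sq_nonneg {α θ : ℝ} (hθ : 0 < θ) (x : ℝ) : 0 ≤ 1 - spd α θ x ^ 2 := by
  nlinarith [spd_pos (α := α) hθ x, spd_le_one (α := α) hθ x]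

lemma one_sub_spd_sq_le_one {α θ : ℝ} (x : ℝ) : 1 - spd α θ x ^ 2 ≤ 1 := by
  nlinarith [sq_nonneg (spd α θ x)]

lemma one_sub_spd_sq_le {α θ x : ℝ} (hθ : 0 < θ) (hx : 0 < x) :
    1 - spd α θ x ^ 2 ≤ θ * x ^ α := by
  rw [spd_sq hθ, max_eq_left hx.le]
  have h : 0 ≤ θ * x ^ α := mul_nonneg hθ.le (Real.rpow_nonneg hx.le _)
  have h1 : (1 + θ * x ^ α) * (1 + θ * x ^ α)⁻¹ = 1 := mul_inv_cancel₀ (by positivity)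
  have h2 : 0 < (1 + θ * x ^ α)⁻¹ := by positivity
  nlinarith [mul_nonneg h h]

lemma hasDerivAt_spd {α θ x : ℝ} (hθ : 0 < θ) (hx : 0 < x) :
    HasDerivAt (spd α θ) (-(α / 2) * spd α θ x * (1 - spd α θ x ^ 2) / x) x := by
  have hE : 0 < 1 + θ * x ^ α := by positivity
  have h1 : HasDerivAt (fun y : ℝ => (1 + θ * y ^ α) ^ (-(1 / 2) : ℝ))
      (θ * (α * x ^ (α - 1)) * (-(1 / 2)) * (1 + θ * x ^ α) ^ (-(1 / 2) - 1 : ℝ)) x :=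
    (((Real.hasDerivAt_rpow_const (Or.inl hx.ne')).const_mul θ).const_add 1).rpow_const
      (Or.inl hE.ne')
  have h2 : spd α θ =ᶠ[𝓝 x] fun y : ℝ => (1 + θ * y ^ α) ^ (-(1 / 2) : ℝ) := by
    filter_upwards [lt_mem_nhds hx] with y hy
    rw [spd, max_eq_left hy.le]
  refine (h1.congr_of_eventuallyEq h2).congr_deriv ?_
  rw [spd_sq hθ, spd, max_eq_left hx.le, Real.rpow_sub_one hE.ne', Real.rpow_sub_one hx.ne']
  field_simp
  ring

lemma hasDerivAt_amp {α θ x : ℝ} (hθ : 0 < θ) (hx : 0 < x) :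
    HasDerivAt (amp α θ) (-(α / 4) * amp α θ x * (1 - spd α θ x ^ 2) / x) x := by
  have hc := spd_pos (α := α) hθ x
  have h1 := (hasDerivAt_spd (α := α) hθ hx).rpow_const (p := 1 / 2) (Or.inl hc.ne')
  refine h1.congr_deriv ?_
  rw [Real.rpow_sub_one hc.ne', amp]
  field_simp
  ring

lemma deriv_amp {α θ x : ℝ} (hθ : 0 < θ) (hx : 0 < x) :
    deriv (fun y => amp α θ y) x = -(α / 4) * amp α θ x * (1 - spd α θ x ^ 2) / x :=
  (hasDerivAt_amp hθ hx).deriv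

lemma Mfun_eq {α θ x : ℝ} (hθ : 0 < θ) (hx : 0 < x) :
    Mfun α θ x = spd α θ x * (1 - spd α θ x ^ 2) *
      (α ^ 2 / 16 + α / 4 - 5 * α ^ 2 / 16 * spd α θ x ^ 2) / x ^ 2 := by
  have h2 : deriv (amp α θ) =ᶠ[𝓝 x]
      fun y => -(α / 4) * amp α θ y * (1 - spd α θ y ^ 2) / y := by
    filter_upwards [lt_mem_nhds hx] with y hy
    exact (hasDerivAt_amp hθ hy).deriv
  have h3 : HasDerivAt (fun y => -(α / 4) * amp α θ y * (1 - spd α θ y ^ 2) / y) _ x :=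
    ((((hasDerivAt_amp (α := α) hθ hx).const_mul (-(α / 4))).mul
      (((hasDerivAt_spd (α := α) hθ hx).pow 2).const_sub 1)).div (hasDerivAt_id x) hx.ne')
  have h4 : Mfun α θ x = amp α θ x * deriv (deriv (amp α θ)) x := if_pos hx
  rw [h4, h2.deriv_eq, h3.deriv, ← amp_sq hθ]
  simp only [Pi.mul_apply, Pi.pow_apply, ← amp_sq hθ]
  field_simp
  ring

lemma hasDerivAt_phase {α θ : ℝ} (hα : 0 < α) (hθ : 0 < θ) (x : ℝ) :
    HasDerivAt (phase α θ) (spd α θ x)⁻¹ x := by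
  have hc : Continuous fun y => (spd α θ y)⁻¹ :=
    (continuous_spd hα hθ).inv₀ fun y => (spd_pos hθ y).ne'
  exact intervalIntegral.integral_hasDerivAt_right (hc.intervalIntegrable _ _)
    (hc.stronglyMeasurableAtFilter _ _) hc.continuousAt

/-- Finite sums of terms `z x⁻ᵐ c(x)ᵏ (1 - c(x)²)` with `m ≥ n`. -/
inductive WKBSymbol (α : ℝ) : ℕ → (ℝ → ℝ → ℂ) → Prop
  | mono (n k : ℕ) (z : ℂ) : WKBSymbol α n fun θ x =>
      z * ((x : ℂ)⁻¹) ^ n * (spd α θ x : ℂ) ^ k * (1 - (spd α θ x : ℂ) ^ 2)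
  | add {n : ℕ} {f g : ℝ → ℝ → ℂ} (hf : WKBSymbol α n f) (hg : WKBSymbol α n g) :
      WKBSymbol α n fun θ x => f θ x + g θ x
  | lower {n : ℕ} {f : ℝ → ℝ → ℂ} (hf : WKBSymbol α (n + 1) f) : WKBSymbol α n f

namespace WKBSymbol

variable {α : ℝ} {n m : ℕ} {f g : ℝ → ℝ → ℂ}

lemma mono_mul (hf : WKBSymbol α n f) (m k : ℕ) (z : ℂ) : WKBSymbol α (m + n) fun θ x =>
    z * ((x : ℂ)⁻¹) ^ m * (spd α θ x : ℂ) ^ k * f θ x := by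
  induction hf with
  | mono n l w =>
    convert mono (α := α) (m + n) (k + l) (z * w) using 3
    ring
  | add _ _ h₁ h₂ =>
    convert h₁.add h₂ using 3
    ring
  | lower _ h => exact lower h

lemma const_mul (hf : WKBSymbol α n f) (z : ℂ) : WKBSymbol α n fun θ x => z * f θ x := by
  simpa using hf.mono_mul 0 0 z

lemma mul (hf : WKBSymbol α n f) (hg : WKBSymbol α m g) :
    WKBSymbol α (n + m) fun θ x => f θ x * g θ x := by
  induction hf with
  | mono n k z =>
    convert (hg.mono_mul n k z).add (hg.mono_mul n (k + 2) (-z)) using 3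
    ring
  | add _ _ h₁ h₂ =>
    convert h₁.add h₂ using 3
    ring
  | @lower n f _ h =>
    rw [Nat.add_right_comm] at h
    exact lower h

lemma exists_hasDerivAt (hf : WKBSymbol α n f) : ∃ f' : ℝ → ℝ → ℂ, WKBSymbol α (n + 1) f' ∧
    ∀ θ x : ℝ, 0 < θ → 0 < x → HasDerivAt (f θ) (f' θ x) x := by
  induction hf with
  | mono n k z =>
    refine ⟨_, ((mono (n + 1) k (-(n + (α / 2) * k) * z)).add
      (mono (n + 1) (k + 2) (z * (α / 2) * (k + 2)))), fun θ x hθ hx => ?_⟩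
    have hx' : (x : ℂ) ≠ 0 := by exact_mod_cast hx.ne'
    have hc : HasDerivAt (fun y : ℝ => (spd α θ y : ℂ)) _ x :=
      (hasDerivAt_spd (α := α) hθ hx).ofReal_comp
    have hi : HasDerivAt (fun y : ℝ => ((y : ℂ)⁻¹)) _ x :=
      ((hasDerivAt_id x).ofReal_comp).fun_inv hx'
    have h := (((hi.fun_pow n).const_mul z).fun_mul (hc.fun_pow k)).fun_mul ((hc.fun_pow 2).const_sub 1)
    refine h.congr_deriv ?_
    have hn : ((n : ℂ)) * ((x : ℂ)⁻¹) ^ (n - 1) = n * ((x : ℂ)⁻¹) ^ n * x := by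
      cases n with
      | zero => simp
      | succ n => simp only [Nat.add_sub_cancel, pow_succ]; field_simp
    have hk : ((k : ℂ)) * (spd α θ x : ℂ) ^ (k - 1) * spd α θ x = k * (spd α θ x : ℂ) ^ k := by
      cases k with
      | zero => simp
      | succ k => simp only [Nat.add_sub_cancel, pow_succ]; ring
    have hn' : z * (n * ((x : ℂ)⁻¹) ^ (n - 1) * (-((1 : ℝ) : ℂ) / (x : ℂ) ^ 2)) =
        -(z * n * ((x : ℂ)⁻¹) ^ (n + 1)) := by
      rw [hn, pow_succ _ n]
      push_cast
      field_simp
    have hk' : (k : ℂ) * (spd α θ x : ℂ) ^ (k - 1) *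
        ((-(α / 2) * spd α θ x * (1 - spd α θ x ^ 2) / x : ℝ) : ℂ) =
        -(α / 2) * (k * (spd α θ x : ℂ) ^ k) * (1 - (spd α θ x : ℂ) ^ 2) * (x : ℂ)⁻¹ := by
      rw [← hk]
      push_cast
      ring
    simp only [id] at *
    rw [hn', hk']
    push_cast
    ring
  | add _ _ h₁ h₂ =>
    obtain ⟨f', hf', hf⟩ := h₁
    obtain ⟨g', hg', hg⟩ := h₂
    exact ⟨_, hf'.add hg', fun θ x hθ hx => (hf θ x hθ hx).add (hg θ x hθ hx)⟩
  | lower _ h =>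
    obtain ⟨f', hf', hf⟩ := h
    exact ⟨f', hf'.lower, hf⟩

lemma continuousOn (hf : WKBSymbol α n f) {θ : ℝ} (hθ : 0 < θ) : ContinuousOn (f θ) (Ioi 0) := by
  obtain ⟨f', -, h⟩ := hf.exists_hasDerivAt
  exact fun x hx => (h θ x hθ hx).continuousAt.continuousWithinAt

lemma exists_norm_le (hf : WKBSymbol α n f) {x₀ : ℝ} (hx₀ : 0 < x₀) : ∃ C > 0, ∀ θ x : ℝ, 0 < θ →
    x₀ ≤ x → ‖f θ x‖ ≤ C * ((x⁻¹) ^ n * (1 - spd α θ x ^ 2)) := by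
  induction hf with
  | mono n k z =>
    refine ⟨‖z‖ + 1, by positivity, fun θ x hθ hx => ?_⟩
    have hx' : 0 < x := hx₀.trans_le hx
    have h1 := one_sub_spd_sq_nonneg (α := α) hθ x
    have e : (1 - (spd α θ x : ℂ) ^ 2) = ((1 - spd α θ x ^ 2 : ℝ) : ℂ) := by push_cast; ring
    beta_reduce
    rw [e, norm_mul, norm_mul, norm_mul, norm_pow, norm_pow, norm_inv, Complex.norm_of_nonneg h1,
      Complex.norm_of_nonneg hx'.le, Complex.norm_of_nonneg (spd_pos hθ x).le, ← mul_assoc]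
    refine mul_le_mul_of_nonneg_right ?_ h1
    have h2 : spd α θ x ^ k ≤ 1 := pow_le_one₀ (spd_pos hθ x).le (spd_le_one hθ x)
    have h3 : 0 ≤ (x⁻¹) ^ n := by positivity
    calc ‖z‖ * x⁻¹ ^ n * spd α θ x ^ k ≤ ‖z‖ * x⁻¹ ^ n * 1 := by gcongr
      _ ≤ (‖z‖ + 1) * x⁻¹ ^ n := by linarith
  | add _ _ h₁ h₂ =>
    obtain ⟨C, hC, h₁⟩ := h₁
    obtain ⟨D, hD, h₂⟩ := h₂
    refine ⟨C + D, by positivity, fun θ x hθ hx => (norm_add_le _ _).trans ?_⟩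
    rw [add_mul]
    exact add_le_add (h₁ θ x hθ hx) (h₂ θ x hθ hx)
  | @lower n f _ h =>
    obtain ⟨C, hC, h⟩ := h
    refine ⟨C * x₀⁻¹, by positivity, fun θ x hθ hx => (h θ x hθ hx).trans ?_⟩
    have hx' : 0 < x := hx₀.trans_le hx
    have h1 := one_sub_spd_sq_nonneg (α := α) hθ x
    have h2 : x⁻¹ ≤ x₀⁻¹ := inv_anti₀ hx₀ hx
    calc C * (x⁻¹ ^ (n + 1) * (1 - spd α θ x ^ 2))
        = C * x⁻¹ * (x⁻¹ ^ n * (1 - spd α θ x ^ 2)) := by ring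
      _ ≤ C * x₀⁻¹ * (x⁻¹ ^ n * (1 - spd α θ x ^ 2)) := by gcongr

end WKBSymbol

/-- The complexified coefficient `M` written as a symbol, valid on `x > 0`. -/
def Msym (α θ x : ℝ) : ℂ := (α ^ 2 / 16 + α / 4) * ((x : ℂ)⁻¹) ^ 2 * (spd α θ x : ℂ) ^ 1 *
    (1 - (spd α θ x : ℂ) ^ 2) +
  (-(5 * α ^ 2 / 16)) * ((x : ℂ)⁻¹) ^ 2 * (spd α θ x : ℂ) ^ 3 * (1 - (spd α θ x : ℂ) ^ 2)

lemma wkbSymbol_Msym (α : ℝ) : WKBSymbol α 2 (Msym α) := (WKBSymbol.mono 2 1 _).add (.mono 2 3 _)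

lemma Mfun_eq_Msym {α θ x : ℝ} (hθ : 0 < θ) (hx : 0 < x) : (Mfun α θ x : ℂ) = Msym α θ x := by
  rw [Mfun_eq hθ hx, Msym]
  push_cast
  ring

/-- Approximate solutions of the Riccati equation `a' = 2i a / c + (2i)⁻¹ M (a - 1)²`, to any
order in `x⁻¹`. -/
lemma exists_approx_riccati (α : ℝ) (n : ℕ) : ∃ a a' ρ : ℝ → ℝ → ℂ, WKBSymbol α 1 a ∧
    WKBSymbol α (n + 1) ρ ∧ ∀ θ x : ℝ, 0 < θ → 0 < x → HasDerivAt (a θ) (a' θ x) x ∧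
      a' θ x = 2 * Complex.I * a θ x / spd α θ x +
        (2 * Complex.I)⁻¹ * Msym α θ x * (a θ x - 1) ^ 2 + ρ θ x := by
  induction n with
  | zero =>
    refine ⟨fun _ _ => 0, fun _ _ => 0, _, ?_, (wkbSymbol_Msym α).lower.const_mul
      (-(2 * Complex.I)⁻¹), fun θ x hθ hx => ⟨hasDerivAt_const _ _, by ring⟩⟩
    simpa using WKBSymbol.mono (α := α) 1 0 0
  | succ n ih =>
    obtain ⟨a, a', ρ, ha, hρ, h⟩ := ih
    have hδ : WKBSymbol α (n + 1) fun θ x => (2 * Complex.I)⁻¹ * spd α θ x * ρ θ x := by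
      simpa using hρ.mono_mul 0 1 (2 * Complex.I)⁻¹
    obtain ⟨δ', hδ', hd⟩ := hδ.exists_hasDerivAt
    set δ : ℝ → ℝ → ℂ := fun θ x => (2 * Complex.I)⁻¹ * spd α θ x * ρ θ x with hδdef
    have hδ1 : WKBSymbol α 1 δ := by
      clear_value δ
      clear hd hδ' hδdef hρ h
      induction n with
      | zero => exact hδ
      | succ n ih => exact ih hδ.lower
    have hMδ : WKBSymbol α (n + 3) fun θ x => Msym α θ x * δ θ x := by
      have := (wkbSymbol_Msym α).mul hδ
      rwa [show 2 + (n + 1) = n + 3 by ring] at this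
    refine ⟨fun θ x => a θ x + δ θ x, fun θ x => a' θ x + δ' θ x, _, ha.add hδ1,
      hδ'.add ((hMδ.lower.const_mul (2 * (2 * Complex.I)⁻¹)).add
        ((hMδ.mul (((ha.const_mul 2).add hδ1).const_mul (-(2 * Complex.I)⁻¹))).lower.lower)),
      fun θ x hθ hx => ⟨(h θ x hθ hx).1.add (hd θ x hθ hx), ?_⟩⟩
    have hc : (spd α θ x : ℂ) ≠ 0 := by exact_mod_cast (spd_pos hθ x).ne'
    have hI : (2 * Complex.I) ≠ 0 := by simp
    have e : 2 * Complex.I * δ θ x / spd α θ x = ρ θ x := by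
      rw [hδdef]; field_simp
    have e2 : 2 * Complex.I * (a θ x + δ θ x) / spd α θ x =
        2 * Complex.I * a θ x / spd α θ x + ρ θ x := by rw [← e]; ring
    beta_reduce
    rw [(h θ x hθ hx).2, e2]
    ring

lemma WKBSymbol.exists_integral_norm_le {α : ℝ} {n : ℕ} {f : ℝ → ℝ → ℂ} (hf : WKBSymbol α n f)
    {x₀ s : ℝ} (hx₀ : 0 < x₀) (hs : 0 < s) (hs1 : s ≤ 1) (hn : α * s + 1 < n) :
    ∃ C > 0, ∀ θ : ℝ, 0 < θ → IntegrableOn (f θ) (Ioi x₀) ∧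
      ∫ x in Ioi x₀, ‖f θ x‖ ≤ C * θ ^ s := by
  obtain ⟨C, hC, h⟩ := hf.exists_norm_le hx₀
  have hlt : α * s - n < -1 := by linarith
  have hb : ∀ θ x : ℝ, 0 < θ → x ∈ Ioi x₀ → ‖f θ x‖ ≤ C * θ ^ s * x ^ (α * s - n) := by
    intro θ x hθ hx
    have hx' : 0 < x := hx₀.trans hx
    refine (h θ x hθ (le_of_lt hx)).trans ?_
    have h0 := one_sub_spd_sq_nonneg (α := α) hθ x
    have h1 : 1 - spd α θ x ^ 2 ≤ θ ^ s * x ^ (α * s) := by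
      calc 1 - spd α θ x ^ 2 ≤ (1 - spd α θ x ^ 2) ^ s := by
            simpa using Real.rpow_le_rpow_of_exponent_ge_of_imp h0
              (one_sub_spd_sq_le_one x) hs1 (fun _ h => absurd h one_ne_zero)
        _ ≤ (θ * x ^ α) ^ s := Real.rpow_le_rpow h0 (one_sub_spd_sq_le hθ hx') hs.le
        _ = θ ^ s * x ^ (α * s) := by
            rw [Real.mul_rpow hθ.le (by positivity), Real.rpow_mul hx'.le]
    calc C * (x⁻¹ ^ n * (1 - spd α θ x ^ 2)) ≤ C * (x⁻¹ ^ n * (θ ^ s * x ^ (α * s))) := by gcongr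
      _ = C * θ ^ s * x ^ (α * s - n) := by
        rw [Real.rpow_sub hx', Real.rpow_natCast, inv_pow]
        field_simp
  have hi := (integrableOn_Ioi_rpow_of_lt hlt hx₀)
  refine ⟨C * (∫ x in Ioi x₀, x ^ (α * s - n)) + 1, ?_, fun θ hθ => ⟨?_, ?_⟩⟩
  · have : 0 ≤ ∫ x in Ioi x₀, x ^ (α * s - n) := setIntegral_nonneg measurableSet_Ioi
      fun x hx => by have : 0 < x := hx₀.trans hx; positivity
    positivity
  · refine Integrable.mono' (hi.const_mul (C * θ ^ s)) ?_ ?_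
    · exact ((hf.continuousOn hθ).mono (Ioi_subset_Ioi hx₀.le)).aestronglyMeasurable
        measurableSet_Ioi
    · exact (ae_restrict_mem measurableSet_Ioi).mono fun x hx => hb θ x hθ hx
  · have h2 : ∫ x in Ioi x₀, ‖f θ x‖ ≤ ∫ x in Ioi x₀, C * θ ^ s * x ^ (α * s - n) := by
      refine integral_mono_of_nonneg (ae_of_all _ fun x => norm_nonneg _)
        (hi.const_mul (C * θ ^ s)) ?_
      exact (ae_restrict_mem measurableSet_Ioi).mono fun x hx => hb θ x hθ hx
    rw [integral_const_mul] at h2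
    have h3 : 0 < θ ^ s := Real.rpow_pos_of_pos hθ s
    linarith

lemma WKBSymbol.exists_integral_norm_le_small {α : ℝ} (hα : 0 < α) {f : ℝ → ℝ → ℂ}
    (hf : WKBSymbol α 2 f) {x₀ ε : ℝ} (hx₀ : 0 < x₀) (hε : 0 < ε) :
    ∃ θ₁ > 0, ∀ θ : ℝ, 0 < θ → θ < θ₁ → IntegrableOn (f θ) (Ioi x₀) ∧
      ∫ x in Ioi x₀, ‖f θ x‖ ≤ ε := by
  have hs : 0 < min 1 (1 / (2 * α)) := by positivity
  obtain ⟨C, hC, h⟩ := hf.exists_integral_norm_le hx₀ hs (min_le_left _ _) (by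
    have : α * min 1 (1 / (2 * α)) ≤ α * (1 / (2 * α)) := by gcongr; exact min_le_right _ _
    have h2 : α * (1 / (2 * α)) = 1 / 2 := by field_simp
    push_cast
    linarith)
  set s := min 1 (1 / (2 * α))
  refine ⟨(ε / C) ^ s⁻¹, by positivity, fun θ hθ hlt => ⟨(h θ hθ).1, (h θ hθ).2.trans ?_⟩⟩
  have h1 : θ ^ s ≤ ε / C := by
    calc θ ^ s ≤ ((ε / C) ^ s⁻¹) ^ s := Real.rpow_le_rpow hθ.le hlt.le hs.le
      _ = ε / C := by rw [← Real.rpow_mul (by positivity), inv_mul_cancel₀ hs.ne', Real.rpow_one]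
  calc C * θ ^ s ≤ C * (ε / C) := by gcongr
    _ = ε := by field_simp

lemma Mtail_eq {α θ x₀ : ℝ} (hθ : 0 < θ) (hx₀ : 0 < x₀) :
    Mtail α θ x₀ = ∫ x in Ioi x₀, ‖Msym α θ x‖ := by
  refine setIntegral_congr_fun measurableSet_Ioi fun x hx => ?_
  rw [← Mfun_eq_Msym hθ (hx₀.trans hx), Complex.norm_real, Real.norm_eq_abs]

lemma continuousOn_Mfun {α θ : ℝ} (hθ : 0 < θ) :
    ContinuousOn (fun x => (Mfun α θ x : ℂ)) (Ioi 0) :=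
  ((wkbSymbol_Msym α).continuousOn hθ).congr fun _ hx => Mfun_eq_Msym hθ hx

/-- A bounded function satisfying a self-improving bound with factor `1/2` is bounded by `2A`. -/
lemma norm_le_two_mul_of_bootstrap {E : Type*} [SeminormedAddCommGroup E] {f : ℝ → E} {s : Set ℝ}
    {A : ℝ} (hb : ∃ K, ∀ x ∈ s, ‖f x‖ ≤ K)
    (h : ∀ B, (∀ x ∈ s, ‖f x‖ ≤ B) → ∀ x ∈ s, ‖f x‖ ≤ A + B / 2) :
    ∀ x ∈ s, ‖f x‖ ≤ 2 * A := by
  intro x hx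
  obtain ⟨K, hK⟩ := hb
  have hbdd : BddAbove ((fun x => ‖f x‖) '' s) := ⟨K, by rintro _ ⟨y, hy, rfl⟩; exact hK y hy⟩
  have h1 : ∀ y ∈ s, ‖f y‖ ≤ sSup ((fun x => ‖f x‖) '' s) :=
    fun y hy => le_csSup hbdd ⟨y, hy, rfl⟩
  have h2 : sSup ((fun x => ‖f x‖) '' s) ≤ A + sSup ((fun x => ‖f x‖) '' s) / 2 :=
    csSup_le ⟨_, x, hx, rfl⟩ (by rintro _ ⟨y, hy, rfl⟩; exact h _ h1 y hy)
  linarith [h1 x hx]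

lemma norm_inv_two_mul_I : ‖(2 * Complex.I)⁻¹‖ = 1 / 2 := by simp

lemma norm_exp_neg_two_mul_I (r : ℝ) : ‖Complex.exp (-2 * Complex.I * (r : ℂ))‖ = 1 := by
  rw [show -2 * Complex.I * (r : ℂ) = ((-2 * r : ℝ) : ℂ) * Complex.I by push_cast; ring]
  exact Complex.norm_exp_ofReal_mul_I _

section Volterra

variable {α θ x₀ : ℝ} {S : ℝ → ℂ}

lemma Kop_zero (x : ℝ) : Kop α θ x₀ 0 S x = (2 * Complex.I)⁻¹ *
    ((∫ y in x₀..x, (Mfun α θ y : ℂ) * S y *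
        Complex.exp (-2 * Complex.I * ((phase α θ x - phase α θ y : ℝ) : ℂ))) +
      ∫ y in Ioi x, (Mfun α θ y : ℂ) * S y) := by
  simp [Kop]

lemma norm_integral_Ioi_mul_le {f g : ℝ → ℂ} {B : ℝ} (hf : IntegrableOn f (Ioi x₀))
    (hg : ∀ x ∈ Ici x₀, ‖g x‖ ≤ B) {x : ℝ} (hx : x₀ ≤ x) :
    ‖∫ y in Ioi x, f y * g y‖ ≤ B * ∫ y in Ioi x, ‖f y‖ := by
  rw [← integral_const_mul]
  refine norm_integral_le_of_norm_le ((hf.mono_set (Ioi_subset_Ioi hx)).norm.const_mul B) ?_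
  filter_upwards [ae_restrict_mem measurableSet_Ioi] with y hy
  rw [norm_mul, mul_comm]
  exact mul_le_mul_of_nonneg_right (hg y (hx.trans (le_of_lt hy))) (norm_nonneg _)

lemma setIntegral_Ioi_norm_anti {f : ℝ → ℂ} (hf : IntegrableOn f (Ioi x₀)) {x : ℝ} (hx : x₀ ≤ x) :
    ∫ y in Ioi x, ‖f y‖ ≤ ∫ y in Ioi x₀, ‖f y‖ :=
  setIntegral_mono_set hf.norm (ae_of_all _ fun _ => norm_nonneg _)
    (Ioi_subset_Ioi hx).eventuallyLE

lemma norm_Kop_zero_le {B : ℝ} (hM : IntegrableOn (fun x => (Mfun α θ x : ℂ)) (Ioi x₀))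
    (hS : ∀ x ∈ Ici x₀, ‖S x‖ ≤ B) {x : ℝ} (hx : x₀ ≤ x) :
    ‖Kop α θ x₀ 0 S x‖ ≤ 1 / 2 * (B * Mtail α θ x₀) := by
  have h1 := norm_integral_Ioi_mul_le hM hS hx
  have h2 : ‖∫ y in x₀..x, (Mfun α θ y : ℂ) * S y *
      Complex.exp (-2 * Complex.I * ((phase α θ x - phase α θ y : ℝ) : ℂ))‖ ≤
      ∫ y in x₀..x, B * ‖(Mfun α θ y : ℂ)‖ := by
    refine intervalIntegral.norm_integral_le_of_norm_le hx (ae_of_all _ fun y hy => ?_) ?_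
    · rw [norm_mul, norm_mul, norm_exp_neg_two_mul_I, mul_one, mul_comm]
      exact mul_le_mul_of_nonneg_right (hS y hy.1.le) (norm_nonneg _)
    · rw [intervalIntegrable_iff_integrableOn_Ioc_of_le hx]
      exact ((hM.mono_set Ioc_subset_Ioi_self).norm).const_mul B
  rw [intervalIntegral.integral_const_mul] at h2
  have h3 := intervalIntegral.integral_interval_add_Ioi hM.norm
    (hM.mono_set (Ioi_subset_Ioi hx)).norm
  have h4 : Mtail α θ x₀ = ∫ y in Ioi x₀, ‖(Mfun α θ y : ℂ)‖ := by
    simp [Mtail]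
  rw [Kop_zero, norm_mul, norm_inv_two_mul_I, h4, ← h3, mul_add B]
  gcongr
  exact (norm_add_le _ _).trans (add_le_add h2 h1)

lemma IsVolterraSol.norm_le_two (hS : IsVolterraSol α θ x₀ S)
    (hM : IntegrableOn (fun x => (Mfun α θ x : ℂ)) (Ioi x₀)) (hMt : Mtail α θ x₀ ≤ 1) :
    ∀ x ∈ Ici x₀, ‖S x‖ ≤ 2 := by
  have := norm_le_two_mul_of_bootstrap (f := S) (A := 1) hS.1 fun B hB x hx => ?_
  · simpa using this
  rw [hS.2.2 x hx]
  refine (norm_add_le _ _).trans (add_le_add (norm_exp_neg_two_mul_I _).le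
    ((norm_Kop_zero_le hM hB hx).trans ?_))
  have hB0 : 0 ≤ B := (norm_nonneg _).trans (hB x hx)
  nlinarith

/-- A solution of the Volterra equation splits as `S = T + Q`, where `T`, `Q` solve a first order
linear system, `T` starts as the pure phase and `Q` vanishes at infinity. -/
lemma IsVolterraSol.exists_system (hS : IsVolterraSol α θ x₀ S) (hα : 0 < α) (hθ : 0 < θ)
    (hx₀ : 0 < x₀) (hM : IntegrableOn (fun x => (Mfun α θ x : ℂ)) (Ioi x₀)) :
    ∃ T Q : ℝ → ℂ,
      (∀ x, 0 < x → HasDerivAt T (-(2 * Complex.I) / spd α θ x * T x +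
        (2 * Complex.I)⁻¹ * (Mfun α θ x * S (max x x₀))) x) ∧
      (∀ x, 0 < x → HasDerivAt Q (-((2 * Complex.I)⁻¹ * (Mfun α θ x * S (max x x₀)))) x) ∧
      (∀ x ∈ Ici x₀, S x = T x + Q x) ∧
      T x₀ = Complex.exp (-2 * Complex.I * (phase α θ x₀ : ℂ)) ∧
      (∀ x ∈ Ici x₀, Q x = (2 * Complex.I)⁻¹ * ∫ y in Ioi x, (Mfun α θ y : ℂ) * S y) ∧
      Tendsto Q atTop (𝓝 0) := by
  obtain ⟨⟨C, hC⟩, hcont, heq⟩ := hS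
  have hSc : Continuous fun x => S (max x x₀) :=
    hcont.comp_continuous (continuous_id.max continuous_const) fun x => mem_Ici.2 (le_max_right x x₀)
  set F : ℝ → ℂ := fun x => (Mfun α θ x : ℂ) * S (max x x₀) with hF
  have hFS : ∀ x ∈ Ici x₀, F x = (Mfun α θ x : ℂ) * S x := fun x hx => by
    rw [hF]; beta_reduce; rw [max_eq_left hx]
  have hFc : ContinuousOn F (Ioi 0) := (continuousOn_Mfun hθ).mul hSc.continuousOn
  have hφ : Continuous (phase α θ) :=
    continuous_iff_continuousAt.2 fun x => (hasDerivAt_phase hα hθ x).continuousAt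
  have hφe : Continuous fun x => Complex.exp (2 * Complex.I * (phase α θ x : ℂ)) := by fun_prop
  have hGc : ContinuousOn (fun x => F x * Complex.exp (2 * Complex.I * (phase α θ x : ℂ))) (Ioi 0) :=
    hFc.mul hφe.continuousOn
  have hFTC : ∀ g : ℝ → ℂ, ContinuousOn g (Ioi 0) → ∀ x, 0 < x →
      HasDerivAt (fun x => ∫ y in x₀..x, g y) (g x) x := fun g hg x hx => by
    have hsub : uIcc x₀ x ⊆ Ioi 0 := fun y hy => (lt_min hx₀ hx).trans_le hy.1
    exact intervalIntegral.integral_hasDerivAt_right (hg.mono hsub).intervalIntegrable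
      (hg.stronglyMeasurableAtFilter isOpen_Ioi x hx) (hg.continuousAt (Ioi_mem_nhds hx))
  have hFi : IntegrableOn F (Ioi x₀) := by
    refine Integrable.mono' (hM.norm.const_mul C)
      ((hFc.mono (Ioi_subset_Ioi hx₀.le)).aestronglyMeasurable measurableSet_Ioi) ?_
    filter_upwards [ae_restrict_mem measurableSet_Ioi] with y hy
    rw [hFS y (mem_Ioi.1 hy).le, norm_mul, mul_comm]
    exact mul_le_mul_of_nonneg_right (hC y (mem_Ioi.1 hy).le) (norm_nonneg _)
  have hQ : ∀ x ∈ Ici x₀, (2 * Complex.I)⁻¹ * ((∫ y in Ioi x₀, F y) - ∫ y in x₀..x, F y) =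
      (2 * Complex.I)⁻¹ * ∫ y in Ioi x, (Mfun α θ y : ℂ) * S y := fun x hx => by
    rw [← intervalIntegral.integral_interval_add_Ioi hFi (hFi.mono_set (Ioi_subset_Ioi hx)),
      add_sub_cancel_left, setIntegral_congr_fun measurableSet_Ioi]
    exact fun y hy => hFS y (hx.out.trans (le_of_lt hy))
  refine ⟨fun x => Complex.exp (-2 * Complex.I * (phase α θ x : ℂ)) * (1 + (2 * Complex.I)⁻¹ *
      ∫ y in x₀..x, F y * Complex.exp (2 * Complex.I * (phase α θ y : ℂ))),
    fun x => (2 * Complex.I)⁻¹ * ((∫ y in Ioi x₀, F y) - ∫ y in x₀..x, F y),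
    fun x hx => ?_, fun x hx => ?_, fun x hx => ?_, by simp, hQ, ?_⟩
  · have h1 := (((hasDerivAt_phase hα hθ x).ofReal_comp).const_mul (-2 * Complex.I)).cexp
    have h2 := (((hFTC _ hGc x hx).const_mul (2 * Complex.I)⁻¹).const_add 1)
    refine (h1.fun_mul h2).congr_deriv ?_
    have h3 : Complex.exp (-2 * Complex.I * (phase α θ x : ℂ)) *
        Complex.exp (2 * Complex.I * (phase α θ x : ℂ)) = 1 := by
      rw [← Complex.exp_add]; simp
    push_cast
    linear_combination (2 * Complex.I)⁻¹ * F x * h3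
  · refine (((hFTC _ hFc x hx).const_sub _).const_mul (2 * Complex.I)⁻¹).congr_deriv ?_
    ring
  · beta_reduce
    rw [hQ x hx, heq x hx, Kop_zero, mul_add, mul_add, mul_one, add_assoc]
    congr 2
    rw [mul_left_comm]
    congr 1
    rw [← intervalIntegral.integral_const_mul]
    refine intervalIntegral.integral_congr fun y hy => ?_
    rw [uIcc_of_le hx] at hy
    rw [hFS y hy.1, mul_left_comm, ← Complex.exp_add]
    congr 2
    push_cast
    ring
  · have := (intervalIntegral_tendsto_integral_Ioi x₀ hFi tendsto_id).const_sub (∫ y in Ioi x₀, F y)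
    simpa using this.const_mul (2 * Complex.I)⁻¹

end Volterra

/-- The reflection coefficient of the smooth half line `[x₀, ∞)` is `O(θ)`. -/
lemma exists_norm_Rx_le {α x₀ : ℝ} (hα : 0 < α) (hx₀ : 0 < x₀) :
    ∃ θ₁ > (0 : ℝ), ∃ C > (0 : ℝ), ∀ θ : ℝ, 0 < θ → θ < θ₁ →
      IntegrableOn (fun x => (Mfun α θ x : ℂ)) (Ioi x₀) ∧ Mtail α θ x₀ ≤ 1 ∧
      ∀ S : ℝ → ℂ, IsVolterraSol α θ x₀ S → ‖Rx α θ x₀ S‖ ≤ C * θ := by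
  obtain ⟨N, hN⟩ := exists_nat_gt α
  obtain ⟨a, a', ρ, ha, hρ, haρ⟩ := exists_approx_riccati α N
  obtain ⟨Ca, hCa, hab⟩ := ha.exists_norm_le hx₀
  obtain ⟨Cρ, hCρ, hρb⟩ := hρ.exists_integral_norm_le hx₀ one_pos le_rfl
    (by push_cast; linarith)
  have hK : 0 < Ca * x₀⁻¹ := by positivity
  obtain ⟨θ₁, hθ₁, hM⟩ := (wkbSymbol_Msym α).exists_integral_norm_le_small hα hx₀
    (ε := 1 / (1 + Ca * x₀⁻¹)) (by positivity)
  refine ⟨θ₁, hθ₁, 6 * Cρ + Ca * x₀⁻¹ * x₀ ^ α, by positivity, fun θ hθ hlt => ?_⟩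
  obtain ⟨hMi', hMt'⟩ := hM θ hθ hlt
  have hMi : IntegrableOn (fun x => (Mfun α θ x : ℂ)) (Ioi x₀) :=
    hMi'.congr_fun (fun x hx => (Mfun_eq_Msym hθ (hx₀.trans hx)).symm) measurableSet_Ioi
  rw [← Mtail_eq hθ hx₀] at hMt'
  have hMt : Mtail α θ x₀ ≤ 1 := hMt'.trans ((div_le_one (by positivity)).2 (by linarith))
  refine ⟨hMi, hMt, fun S hS => ?_⟩
  have hS2 := hS.norm_le_two hMi hMt
  obtain ⟨T, Q, hT, hQ, hTQ, hT0, hQi, hQlim⟩ := hS.exists_system hα hθ hx₀ hMi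
  have hMtail : Mtail α θ x₀ = ∫ y in Ioi x₀, ‖(Mfun α θ y : ℂ)‖ := by simp [Mtail]
  have hQb : ∀ x ∈ Ici x₀, ‖Q x‖ ≤ 1 := fun x hx => by
    rw [hQi x hx, norm_mul, norm_inv_two_mul_I]
    have h1 := norm_integral_Ioi_mul_le hMi hS2 hx
    have h2 := setIntegral_Ioi_norm_anti hMi hx
    linarith
  have hTb : ∀ x ∈ Ici x₀, ‖T x‖ ≤ 3 := fun x hx => by
    have : T x = S x - Q x := by rw [hTQ x hx]; ring
    rw [this]
    exact (norm_sub_le _ _).trans (by linarith [hS2 x hx, hQb x hx])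
  have hpos : ∀ x ∈ Ici x₀, 0 < x := fun x hx => hx₀.trans_le hx
  have hat : ∀ x ∈ Ici x₀, ‖a θ x‖ ≤ Ca * x⁻¹ := fun x hx => by
    refine (hab θ x hθ hx).trans ?_
    have := hpos x hx
    rw [pow_one]
    exact mul_le_mul_of_nonneg_left
      (mul_le_of_le_one_right (by positivity) (one_sub_spd_sq_le_one x)) hCa.le
  have haK : ∀ x ∈ Ici x₀, ‖a θ x‖ ≤ Ca * x₀⁻¹ := fun x hx =>
    (hat x hx).trans (mul_le_mul_of_nonneg_left (inv_anti₀ hx₀ hx) hCa.le)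
  set Y : ℝ → ℂ := fun x => a θ x * T x + Q x with hY
  set g : ℝ → ℂ := fun x => (2 * Complex.I)⁻¹ * (a θ x - 1) * Y x with hg
  have hYd : ∀ x ∈ Ici x₀, HasDerivAt Y (ρ θ x * T x + Mfun α θ x * g x) x := fun x hx => by
    have hx' := hpos x hx
    obtain ⟨h1, h2⟩ := haρ θ x hθ hx'
    refine ((h1.fun_mul (hT x hx')).fun_add (hQ x hx')).congr_deriv ?_
    rw [h2, max_eq_left hx.out, hTQ x hx, ← Mfun_eq_Msym hθ hx', hg]
    ring
  have hYb : ∃ K, ∀ x ∈ Ici x₀, ‖Y x‖ ≤ K := ⟨Ca * x₀⁻¹ * 3 + 1, fun x hx => by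
    refine (norm_add_le _ _).trans (add_le_add ?_ (hQb x hx))
    rw [norm_mul]
    exact mul_le_mul (haK x hx) (hTb x hx) (norm_nonneg _) hK.le⟩
  have hgb : ∀ B, (∀ x ∈ Ici x₀, ‖Y x‖ ≤ B) → ∀ x ∈ Ici x₀,
      ‖g x‖ ≤ 1 / 2 * (1 + Ca * x₀⁻¹) * B := fun B hB x hx => by
    rw [hg]
    beta_reduce
    rw [norm_mul, norm_mul, norm_inv_two_mul_I]
    have : ‖a θ x - 1‖ ≤ 1 + Ca * x₀⁻¹ := by
      refine (norm_sub_le _ _).trans ?_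
      rw [norm_one]
      linarith [haK x hx]
    gcongr
    exact hB x hx
  have hTc : ContinuousOn T (Ioi x₀) := fun x hx =>
    (hT x (hx₀.trans hx)).continuousAt.continuousWithinAt
  have hYc : ContinuousOn Y (Ioi x₀) := fun x hx =>
    (hYd x (mem_Ioi.1 hx).le).continuousAt.continuousWithinAt
  have hac : ContinuousOn (a θ) (Ioi x₀) := (ha.continuousOn hθ).mono (Ioi_subset_Ioi hx₀.le)
  have hgc : ContinuousOn g (Ioi x₀) := by fun_prop
  have hi1 : IntegrableOn (fun x => ρ θ x * T x) (Ioi x₀) :=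
    (hρb θ hθ).1.mul_bdd (c := 3) (hTc.aestronglyMeasurable measurableSet_Ioi)
      ((ae_restrict_mem measurableSet_Ioi).mono fun x hx => hTb x (mem_Ioi.1 hx).le)
  have hi2 : IntegrableOn (fun x => (Mfun α θ x : ℂ) * g x) (Ioi x₀) := by
    obtain ⟨K, hK⟩ := hYb
    exact hMi.mul_bdd (hgc.aestronglyMeasurable measurableSet_Ioi)
      ((ae_restrict_mem measurableSet_Ioi).mono fun x hx => hgb K hK x (mem_Ioi.1 hx).le)
  have hYlim : Tendsto Y atTop (𝓝 0) := by
    have h1 : Tendsto (fun x => a θ x * T x) atTop (𝓝 0) := by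
      have h2 : Tendsto (fun x : ℝ => Ca * x⁻¹ * 3) atTop (𝓝 0) := by
        simpa using (tendsto_inv_atTop_zero.const_mul Ca).mul_const 3
      refine squeeze_zero_norm' ?_ h2
      filter_upwards [eventually_ge_atTop x₀] with x hx
      rw [norm_mul]
      exact mul_le_mul (hat x hx) (hTb x hx) (norm_nonneg _)
        (mul_nonneg hCa.le (inv_nonneg.2 (hpos x hx).le))
    simpa using h1.add hQlim
  have hYle : ∀ x ∈ Ici x₀, ‖Y x‖ ≤ 2 * (3 * (Cρ * θ)) := by
    refine norm_le_two_mul_of_bootstrap hYb fun B hB x hx => ?_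
    have hsub : Ioi x ⊆ Ioi x₀ := Ioi_subset_Ioi hx
    have hftc := integral_Ioi_of_hasDerivAt_of_tendsto' (fun y hy => hYd y (hx.out.trans hy))
      ((hi1.add hi2).mono_set hsub) hYlim
    rw [integral_add (hi1.mono_set hsub) (hi2.mono_set hsub), zero_sub] at hftc
    rw [← norm_neg, ← hftc]
    refine (norm_add_le _ _).trans (add_le_add ?_ ?_)
    · refine (norm_integral_Ioi_mul_le (hρb θ hθ).1 hTb hx).trans ?_
      have := (setIntegral_Ioi_norm_anti (hρb θ hθ).1 hx).trans (hρb θ hθ).2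
      rw [Real.rpow_one] at this
      linarith
    · refine (norm_integral_Ioi_mul_le hMi (hgb B hB) hx).trans ?_
      have h1 := setIntegral_Ioi_norm_anti hMi hx
      rw [← hMtail] at h1
      have hB0 : 0 ≤ B := (norm_nonneg _).trans (hB x hx)
      calc 1 / 2 * (1 + Ca * x₀⁻¹) * B * ∫ y in Ioi x, ‖(Mfun α θ y : ℂ)‖
          ≤ 1 / 2 * (1 + Ca * x₀⁻¹) * B * (1 / (1 + Ca * x₀⁻¹)) := by
            gcongr
            exact h1.trans hMt'
        _ = B / 2 := by field_simp
  have hx₀m : x₀ ∈ Ici x₀ := self_mem_Ici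
  have hR : Rx α θ x₀ S = Y x₀ - a θ x₀ * T x₀ := by
    rw [Rx, ← hQi x₀ hx₀m, hY]
    ring
  have ha0 : ‖a θ x₀‖ ≤ Ca * x₀⁻¹ * x₀ ^ α * θ := by
    refine (hab θ x₀ hθ le_rfl).trans ?_
    rw [pow_one]
    calc Ca * (x₀⁻¹ * (1 - spd α θ x₀ ^ 2)) ≤ Ca * (x₀⁻¹ * (θ * x₀ ^ α)) := by
          gcongr
          exact one_sub_spd_sq_le hθ hx₀
      _ = Ca * x₀⁻¹ * x₀ ^ α * θ := by ring
  rw [hR]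
  refine (norm_sub_le _ _).trans ?_
  rw [norm_mul, hT0, norm_exp_neg_two_mul_I, mul_one]
  linarith [hYle x₀ hx₀m]

/-- First order perturbation theory for the off-diagonal system `p' = -r ē q`, `q' = -r e p` on
`[0, x₀]` with `p ≈ 1`, `q ≈ 0` at `x₀`. -/
lemma coupled_system_estimate {x₀ δ : ℝ} {p q e e' : ℝ → ℂ} {r : ℝ → ℝ} (hx₀ : 0 < x₀)
    (hδ : δ ≤ 1 / 8) (hp : ContinuousOn p (Icc 0 x₀)) (hq : ContinuousOn q (Icc 0 x₀))
    (he : Continuous e) (he' : Continuous e') (hen : ∀ x, ‖e x‖ = 1) (hen' : ∀ x, ‖e' x‖ = 1)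
    (hpd : ∀ x ∈ Ioo 0 x₀, HasDerivAt p (-(r x * (e' x * q x))) x)
    (hqd : ∀ x ∈ Ioo 0 x₀, HasDerivAt q (-(r x * (e x * p x))) x)
    (hr : IntervalIntegrable r volume 0 x₀) (hrδ : ∫ x in (0 : ℝ)..x₀, |r x| ≤ δ)
    (hp₀ : ‖p x₀ - 1‖ ≤ δ) (hq₀ : ‖q x₀‖ ≤ δ) :
    p 0 ≠ 0 ∧ ‖q 0 / p 0 - q x₀ - ∫ x in (0 : ℝ)..x₀, (r x : ℂ) * e x‖ ≤ 36 * δ ^ 2 := by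
  have hδ0 : 0 ≤ δ := (norm_nonneg _).trans hq₀
  have hrc : IntervalIntegrable (fun x => (r x : ℂ)) volume 0 x₀ := ⟨hr.1.ofReal, hr.2.ofReal⟩
  have hsub : ∀ x ∈ Icc 0 x₀, uIcc x x₀ ⊆ uIcc 0 x₀ := fun x hx => by
    rw [uIcc_of_le hx.2, uIcc_of_le hx₀.le]
    exact Icc_subset_Icc_left hx.1
  have hint : ∀ f : ℝ → ℂ, ContinuousOn f (Icc 0 x₀) → ∀ x ∈ Icc 0 x₀,
      IntervalIntegrable (fun y => (r y : ℂ) * f y) volume x x₀ := fun f hf x hx =>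
    (hrc.mul_continuousOn (by rwa [uIcc_of_le hx₀.le])).mono_set (hsub x hx)
  have hbound : ∀ (f : ℝ → ℂ) (B : ℝ), (∀ y ∈ Icc 0 x₀, ‖f y‖ ≤ B) → ∀ x ∈ Icc 0 x₀,
      ‖∫ y in x..x₀, (r y : ℂ) * f y‖ ≤ δ * B := fun f B hB x hx => by
    have hB0 : 0 ≤ B := (norm_nonneg _).trans (hB x hx)
    have h1 : ‖∫ y in x..x₀, (r y : ℂ) * f y‖ ≤ ∫ y in x..x₀, |r y| * B := by
      refine intervalIntegral.norm_integral_le_of_norm_le hx.2 (ae_of_all _ fun y hy => ?_)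
        ((hr.mono_set (hsub x hx)).abs.mul_const B)
      rw [norm_mul, Complex.norm_real, Real.norm_eq_abs]
      exact mul_le_mul_of_nonneg_left (hB y ⟨hx.1.trans hy.1.le, hy.2⟩) (abs_nonneg _)
    rw [intervalIntegral.integral_mul_const] at h1
    have h2 : ∫ y in x..x₀, |r y| ≤ ∫ y in (0 : ℝ)..x₀, |r y| :=
      intervalIntegral.integral_mono_interval hx.1 hx.2 le_rfl (ae_of_all _ fun _ => abs_nonneg _)
        hr.abs
    exact h1.trans (mul_le_mul_of_nonneg_right (h2.trans hrδ) hB0)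
  have hFTC : ∀ f g : ℝ → ℂ, ContinuousOn f (Icc 0 x₀) → ContinuousOn g (Icc 0 x₀) →
      (∀ x ∈ Ioo 0 x₀, HasDerivAt f (-(r x * g x)) x) → ∀ x ∈ Icc 0 x₀,
      f x = f x₀ + ∫ y in x..x₀, (r y : ℂ) * g y := fun f g hf hg hfd x hx => by
    have h := intervalIntegral.integral_eq_sub_of_hasDerivAt_of_le hx.2
      (hf.mono (Icc_subset_Icc_left hx.1)) (fun y hy => hfd y ⟨hx.1.trans_lt hy.1, hy.2⟩)
      (hint g hg x hx).neg
    rw [intervalIntegral.integral_neg] at h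
    linear_combination h
  have hpF := hFTC p (fun x => e' x * q x) hp (he'.continuousOn.mul hq) hpd
  have hqF := hFTC q (fun x => e x * p x) hq (he.continuousOn.mul hp) hqd
  have hmul : ∀ (f g : ℝ → ℂ) (B : ℝ), (∀ x, ‖f x‖ = 1) → (∀ y ∈ Icc 0 x₀, ‖g y‖ ≤ B) →
      ∀ y ∈ Icc 0 x₀, ‖f y * g y‖ ≤ B := fun f g B hf hg y hy => by
    rw [norm_mul, hf, one_mul]
    exact hg y hy
  have hsup : ∀ x ∈ Icc 0 x₀, ‖(p x, q x)‖ ≤ 2 * (1 + δ) := by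
    refine norm_le_two_mul_of_bootstrap (isCompact_Icc.exists_bound_of_continuousOn (hp.prodMk hq))
      fun B hB x hx => ?_
    have hB0 : 0 ≤ B := (norm_nonneg _).trans (hB x hx)
    have h1 := hbound _ B (hmul e' q B hen' fun y hy => (norm_snd_le (p y, q y)).trans (hB y hy)) x hx
    have h2 := hbound _ B (hmul e p B hen fun y hy => (norm_fst_le (p y, q y)).trans (hB y hy)) x hx
    have h3 : ‖p x₀‖ ≤ 1 + δ := by
      calc ‖p x₀‖ = ‖1 + (p x₀ - 1)‖ := by ring_nf
        _ ≤ 1 + δ := (norm_add_le _ _).trans (by rw [norm_one]; linarith)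
    have h4 : δ * B ≤ B / 2 := by nlinarith
    refine max_le ?_ ?_
    · change ‖p x‖ ≤ _
      rw [hpF x hx]
      exact (norm_add_le _ _).trans (add_le_add h3 (h1.trans h4))
    · change ‖q x‖ ≤ _
      rw [hqF x hx]
      exact (norm_add_le _ _).trans (add_le_add (by linarith) (h2.trans h4))
  have hp3 : ∀ x ∈ Icc 0 x₀, ‖p x‖ ≤ 3 := fun x hx =>
    (norm_fst_le (p x, q x)).trans ((hsup x hx).trans (by linarith))
  have hq3 : ∀ x ∈ Icc 0 x₀, ‖q x‖ ≤ 3 := fun x hx =>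
    (norm_snd_le (p x, q x)).trans ((hsup x hx).trans (by linarith))
  have hp1 : ∀ x ∈ Icc 0 x₀, ‖p x - 1‖ ≤ 4 * δ := fun x hx => by
    rw [hpF x hx, add_sub_right_comm]
    exact (norm_add_le _ _).trans (by linarith [hbound _ 3 (hmul e' q 3 hen' hq3) x hx])
  have h0 : (0 : ℝ) ∈ Icc 0 x₀ := ⟨le_rfl, hx₀.le⟩
  have hq4 : ‖q 0‖ ≤ 4 * δ := by
    rw [hqF 0 h0]
    exact (norm_add_le _ _).trans (by linarith [hbound _ 3 (hmul e p 3 hen hp3) 0 h0])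
  have hplow : 1 / 2 ≤ ‖p 0‖ := by
    have h1 : ‖(1 : ℂ)‖ ≤ ‖p 0‖ + ‖p 0 - 1‖ := by
      calc ‖(1 : ℂ)‖ = ‖p 0 - (p 0 - 1)‖ := by ring_nf
        _ ≤ _ := norm_sub_le _ _
    rw [norm_one] at h1
    linarith [hp1 0 h0]
  have hpne : p 0 ≠ 0 := norm_pos_iff.1 (by linarith)
  refine ⟨hpne, ?_⟩
  have hsplit : q 0 / p 0 - q x₀ - ∫ x in (0 : ℝ)..x₀, (r x : ℂ) * e x =
      -(q 0 * (p 0 - 1) / p 0) + ∫ x in (0 : ℝ)..x₀, (r x : ℂ) * (e x * (p x - 1)) := by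
    have h1 : ∫ x in (0 : ℝ)..x₀, (r x : ℂ) * (e x * (p x - 1)) =
        (∫ x in (0 : ℝ)..x₀, (r x : ℂ) * (e x * p x)) - ∫ x in (0 : ℝ)..x₀, (r x : ℂ) * e x := by
      rw [← intervalIntegral.integral_sub (hint (fun x => e x * p x) (he.continuousOn.mul hp) 0 h0)
        (hint e he.continuousOn 0 h0)]
      congr 1
      ext x
      ring
    have h2 : q 0 / p 0 = q 0 - q 0 * (p 0 - 1) / p 0 := by
      field_simp
      ring
    rw [h1, h2]
    linear_combination hqF 0 h0
  rw [hsplit]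
  have h1 : ‖q 0 * (p 0 - 1) / p 0‖ ≤ 32 * δ ^ 2 := by
    rw [norm_div, norm_mul, div_le_iff₀ (by linarith)]
    have := mul_le_mul hq4 (hp1 0 h0) (norm_nonneg _) (by linarith)
    nlinarith [sq_nonneg δ]
  have h2 := hbound _ (4 * δ) (hmul e (fun x => p x - 1) _ hen hp1) 0 h0
  refine (norm_add_le _ _).trans ?_
  rw [norm_neg]
  linarith

section Matching

variable {α θ : ℝ} {u u' : ℝ → ℂ}

/-- Amplitude of the right-going WKB wave in the instantaneous frame. -/
def waveRight (α θ : ℝ) (u u' : ℝ → ℂ) (x : ℝ) : ℂ :=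
  (u x + Complex.I * spd α θ x * u' x) * Complex.exp (Complex.I * (phase α θ x : ℂ)) /
    (2 * amp α θ x)

/-- Amplitude of the left-going WKB wave in the instantaneous frame. -/
def waveLeft (α θ : ℝ) (u u' : ℝ → ℂ) (x : ℝ) : ℂ :=
  (u x - Complex.I * spd α θ x * u' x) * Complex.exp (-Complex.I * (phase α θ x : ℂ)) /
    (2 * amp α θ x)

/-- The coupling coefficient `b'/b`. -/
def coupling (α θ x : ℝ) : ℝ := deriv (fun z => amp α θ z) x / amp α θ x

lemma coupling_eq {x : ℝ} (hθ : 0 < θ) (hx : 0 < x) :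
    coupling α θ x = -(α / 4) * (1 - spd α θ x ^ 2) / x := by
  have := (amp_pos (α := α) hθ x).ne'
  rw [coupling, deriv_amp hθ hx]
  field_simp

lemma abs_coupling_le {x : ℝ} (hα : 0 < α) (hθ : 0 < θ) (hx : 0 < x) :
    |coupling α θ x| ≤ α / 4 * θ * x ^ (α - 1) := by
  have h0 := one_sub_spd_sq_nonneg (α := α) hθ x
  have h1 : |coupling α θ x| = α / 4 * (1 - spd α θ x ^ 2) / x := by
    rw [coupling_eq hθ hx, neg_mul, neg_div, abs_neg, abs_of_nonneg (by positivity)]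
  rw [h1, Real.rpow_sub_one hx.ne']
  calc α / 4 * (1 - spd α θ x ^ 2) / x ≤ α / 4 * (θ * x ^ α) / x := by
        gcongr
        exact one_sub_spd_sq_le hθ hx
    _ = α / 4 * θ * (x ^ α / x) := by ring

lemma intervalIntegrable_coupling {x₀ : ℝ} (hα : 0 < α) (hθ : 0 < θ) (hx₀ : 0 < x₀) :
    IntervalIntegrable (coupling α θ) volume 0 x₀ ∧
      ∫ x in (0 : ℝ)..x₀, |coupling α θ x| ≤ x₀ ^ α / 4 * θ := by
  have hi : IntervalIntegrable (fun x : ℝ => α / 4 * θ * x ^ (α - 1)) volume 0 x₀ :=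
    (intervalIntegral.intervalIntegrable_rpow' (by linarith)).const_mul _
  have hc : ContinuousOn (coupling α θ) (Ioi 0) := by
    have h1 : ContinuousOn (fun x => -(α / 4) * (1 - spd α θ x ^ 2) / x) (Ioi 0) :=
      (continuousOn_const.mul (continuousOn_const.sub
        ((continuous_spd hα hθ).continuousOn.pow 2))).div continuousOn_id fun x hx => ne_of_gt hx
    exact h1.congr fun x hx => coupling_eq hθ hx
  have hle : ∀ᵐ x ∂volume, x ∈ Ioc 0 x₀ → ‖coupling α θ x‖ ≤ α / 4 * θ * x ^ (α - 1) :=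
    ae_of_all _ fun x hx => abs_coupling_le hα hθ hx.1
  have hr : IntervalIntegrable (coupling α θ) volume 0 x₀ := by
    rw [intervalIntegrable_iff_integrableOn_Ioc_of_le hx₀.le] at hi ⊢
    exact Integrable.mono' hi
      ((hc.mono Ioc_subset_Ioi_self).aestronglyMeasurable measurableSet_Ioc)
      ((ae_restrict_iff' measurableSet_Ioc).2 hle)
  refine ⟨hr, ?_⟩
  have h1 : ∫ x in (0 : ℝ)..x₀, |coupling α θ x| ≤
      ∫ x in (0 : ℝ)..x₀, α / 4 * θ * x ^ (α - 1) := by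
    rw [intervalIntegral.integral_of_le hx₀.le, intervalIntegral.integral_of_le hx₀.le]
    rw [intervalIntegrable_iff_integrableOn_Ioc_of_le hx₀.le] at hr hi
    exact integral_mono_ae hr.abs hi ((ae_restrict_iff' measurableSet_Ioc).2 hle)
  refine h1.trans (le_of_eq ?_)
  rw [intervalIntegral.integral_const_mul, integral_rpow (Or.inl (by linarith)), sub_add_cancel,
    Real.zero_rpow hα.ne']
  field_simp
  ring

lemma hasDerivAt_waves {x : ℝ} (hα : 0 < α) (hθ : 0 < θ) (hx : 0 < x)
    (hu : HasDerivAt u (u' x) x) (hu' : HasDerivAt u' (-((spd α θ x : ℂ))⁻¹ ^ 2 * u x) x) :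
    HasDerivAt (waveRight α θ u u') (-(coupling α θ x *
      (Complex.exp (2 * Complex.I * (phase α θ x : ℂ)) * waveLeft α θ u u' x))) x ∧
    HasDerivAt (waveLeft α θ u u') (-(coupling α θ x *
      (Complex.exp (-2 * Complex.I * (phase α θ x : ℂ)) * waveRight α θ u u' x))) x := by
  have hcne : (spd α θ x : ℂ) ≠ 0 := by exact_mod_cast (spd_pos hθ x).ne'
  have hbne : (amp α θ x : ℂ) ≠ 0 := by exact_mod_cast (amp_pos hθ x).ne'
  have hc := (hasDerivAt_spd (α := α) hθ hx).ofReal_comp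
  have hb := ((hasDerivAt_amp (α := α) hθ hx).ofReal_comp).const_mul (2 : ℂ)
  have hφ := (hasDerivAt_phase hα hθ x).ofReal_comp
  have hxne : (x : ℂ) ≠ 0 := by exact_mod_cast hx.ne'
  have hr : (coupling α θ x : ℂ) = -(α / 4) * (1 - (spd α θ x : ℂ) ^ 2) / x := by
    rw [coupling_eq hθ hx]; push_cast; ring
  have e1 : Complex.exp (2 * Complex.I * (phase α θ x : ℂ)) =
      Complex.exp (Complex.I * (phase α θ x : ℂ)) * Complex.exp (Complex.I * (phase α θ x : ℂ)) := by
    rw [← Complex.exp_add]; ring_nf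
  have e2 : Complex.exp (-2 * Complex.I * (phase α θ x : ℂ)) =
      (Complex.exp (Complex.I * (phase α θ x : ℂ)))⁻¹ *
        (Complex.exp (Complex.I * (phase α θ x : ℂ)))⁻¹ := by
    rw [← Complex.exp_neg, ← Complex.exp_add]; ring_nf
  have e3 : Complex.exp (-Complex.I * (phase α θ x : ℂ)) =
      (Complex.exp (Complex.I * (phase α θ x : ℂ)))⁻¹ := by
    rw [← Complex.exp_neg]; ring_nf
  have hene := Complex.exp_ne_zero (Complex.I * (phase α θ x : ℂ))
  constructor
  · refine (((hu.fun_add ((hc.const_mul Complex.I).fun_mul hu')).fun_mul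
      ((hφ.const_mul Complex.I).cexp)).fun_div hb (by simpa using hbne)).congr_deriv ?_
    rw [hr, waveLeft, e1, e3]
    push_cast
    generalize Complex.exp (Complex.I * (phase α θ x : ℂ)) = e at *
    field_simp
    ring_nf
    simp only [Complex.I_sq]
    ring
  · refine (((hu.fun_sub ((hc.const_mul Complex.I).fun_mul hu')).fun_mul
      ((hφ.const_mul (-Complex.I)).cexp)).fun_div hb (by simpa using hbne)).congr_deriv ?_
    rw [hr, waveRight, e2, e3]
    push_cast
    generalize Complex.exp (Complex.I * (phase α θ x : ℂ)) = e at *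
    field_simp
    ring_nf
    simp only [Complex.I_sq]
    ring

lemma waves_zero {A B : ℂ} (hα : 0 < α) (hu : HasDerivAt u (u' 0) 0)
    (hAB : ∀ x : ℝ, x ≤ 0 → u x =
      B * Complex.exp (-Complex.I * (x : ℂ)) + A * Complex.exp (Complex.I * (x : ℂ))) :
    waveRight α θ u u' 0 = B ∧ waveLeft α θ u u' 0 = A := by
  have hx := (hasDerivAt_id (0 : ℝ)).ofReal_comp
  have h1 := ((hx.const_mul (-Complex.I)).cexp.const_mul B).fun_add
    ((hx.const_mul Complex.I).cexp.const_mul A)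
  have h2 : u' 0 = -Complex.I * B + Complex.I * A := by
    have := UniqueDiffWithinAt.eq_deriv (Iic 0) (uniqueDiffOn_Iic (0 : ℝ) 0 self_mem_Iic)
      hu.hasDerivWithinAt (h1.hasDerivWithinAt.congr (fun x hx => hAB x hx) (hAB 0 le_rfl))
    rw [this]
    simp
    ring
  have h3 := hAB 0 le_rfl
  have h4 : spd α θ 0 = 1 := by simp [spd, Real.zero_rpow hα.ne']
  have h5 : amp α θ 0 = 1 := by simp [amp, h4]
  have h6 : phase α θ 0 = 0 := by simp [phase]
  simp only [Complex.ofReal_zero, mul_zero, Complex.exp_zero, mul_one] at h3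
  have hI := Complex.I_mul_I
  constructor
  · simp only [waveRight, h2, h3, h4, h5, h6, Complex.ofReal_zero, mul_zero, Complex.exp_zero,
      Complex.ofReal_one]
    linear_combination (A - B) / 2 * hI
  · simp only [waveLeft, h2, h3, h4, h5, h6, Complex.ofReal_zero, mul_zero, Complex.exp_zero,
      Complex.ofReal_one]
    linear_combination (B - A) / 2 * hI

lemma waves_match {x₀ : ℝ} {S : ℝ → ℂ} (hα : 0 < α) (hθ : 0 < θ) (hx₀ : 0 < x₀)
    (hM : IntegrableOn (fun x => (Mfun α θ x : ℂ)) (Ioi x₀)) (hS : IsVolterraSol α θ x₀ S)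
    (hu : HasDerivAt u (u' x₀) x₀) (huS : ∀ x ∈ Ici x₀, u x = S x * vminus α θ x) :
    waveRight α θ u u' x₀ = 1 - (2 * Complex.I)⁻¹ * (spd α θ x₀ * coupling α θ x₀) *
      (Complex.exp (2 * Complex.I * (phase α θ x₀ : ℂ)) * S x₀) ∧
    waveLeft α θ u u' x₀ = Rx α θ x₀ S +
      (2 * Complex.I)⁻¹ * (spd α θ x₀ * coupling α θ x₀) * S x₀ ∧
    S x₀ = Complex.exp (-2 * Complex.I * (phase α θ x₀ : ℂ)) + Rx α θ x₀ S := by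
  have hcne : (spd α θ x₀ : ℂ) ≠ 0 := by exact_mod_cast (spd_pos hθ x₀).ne'
  have hbne : (amp α θ x₀ : ℂ) ≠ 0 := by exact_mod_cast (amp_pos hθ x₀).ne'
  obtain ⟨T, Q, hT, hQ, hTQ, hT0, hQi, -⟩ := hS.exists_system hα hθ hx₀ hM
  have hm : x₀ ∈ Ici x₀ := self_mem_Ici
  have hQ0 : Q x₀ = Rx α θ x₀ S := hQi x₀ hm
  have hb := (hasDerivAt_amp (α := α) hθ hx₀).ofReal_comp
  have hφ := (hasDerivAt_phase hα hθ x₀).ofReal_comp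
  have hd := ((hT x₀ hx₀).fun_add (hQ x₀ hx₀)).fun_mul
    (hb.fun_mul (hφ.const_mul Complex.I).cexp)
  have hu0 : u' x₀ = _ := UniqueDiffWithinAt.eq_deriv (Ici x₀) (uniqueDiffOn_Ici x₀ x₀ hm)
    hu.hasDerivWithinAt (hd.hasDerivWithinAt.congr
      (fun x hx => by rw [huS x hx, hTQ x hx, vminus]) (by rw [huS x₀ hm, hTQ x₀ hm, vminus]))
  have hr : (coupling α θ x₀ : ℂ) = -(α / 4) * (1 - (spd α θ x₀ : ℂ) ^ 2) / x₀ := by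
    rw [coupling_eq hθ hx₀]; push_cast; ring
  have hS0 : S x₀ = Complex.exp (-2 * Complex.I * (phase α θ x₀ : ℂ)) + Rx α θ x₀ S := by
    rw [hTQ x₀ hm, hT0, hQ0]
  have hu1 : u' x₀ = (-(2 * Complex.I) / spd α θ x₀ *
      Complex.exp (-2 * Complex.I * (phase α θ x₀ : ℂ)) +
      (coupling α θ x₀ + Complex.I / spd α θ x₀) * S x₀) *
      (amp α θ x₀ * Complex.exp (Complex.I * (phase α θ x₀ : ℂ))) := by
    rw [hu0, hr, ← hTQ x₀ hm, hT0]
    push_cast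
    ring
  have e1 : Complex.exp (2 * Complex.I * (phase α θ x₀ : ℂ)) =
      Complex.exp (Complex.I * (phase α θ x₀ : ℂ)) *
        Complex.exp (Complex.I * (phase α θ x₀ : ℂ)) := by
    rw [← Complex.exp_add]; ring_nf
  have e2 : Complex.exp (-2 * Complex.I * (phase α θ x₀ : ℂ)) =
      (Complex.exp (Complex.I * (phase α θ x₀ : ℂ)))⁻¹ *
        (Complex.exp (Complex.I * (phase α θ x₀ : ℂ)))⁻¹ := by
    rw [← Complex.exp_neg, ← Complex.exp_add]; ring_nf
  have e3 : Complex.exp (-Complex.I * (phase α θ x₀ : ℂ)) =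
      (Complex.exp (Complex.I * (phase α θ x₀ : ℂ)))⁻¹ := by
    rw [← Complex.exp_neg]; ring_nf
  have hene := Complex.exp_ne_zero (Complex.I * (phase α θ x₀ : ℂ))
  have hRS : Rx α θ x₀ S = S x₀ - Complex.exp (-2 * Complex.I * (phase α θ x₀ : ℂ)) := by
    rw [hS0]; ring
  have hI : (2 * Complex.I)⁻¹ = -Complex.I / 2 := by simp; ring
  refine ⟨?_, ?_, hS0⟩
  · rw [waveRight, hu1, huS x₀ hm, vminus, e1, e2, hI]
    generalize Complex.exp (Complex.I * (phase α θ x₀ : ℂ)) = e at *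
    field_simp
    ring_nf
    simp only [Complex.I_sq]
    ring
  · rw [waveLeft, hu1, huS x₀ hm, vminus, hRS, e3, e2, hI]
    generalize Complex.exp (Complex.I * (phase α θ x₀ : ℂ)) = e at *
    field_simp
    ring_nf
    simp only [Complex.I_sq]
    ring

end Matching

lemma continuous_waves {α θ : ℝ} {u u' : ℝ → ℂ} (hα : 0 < α) (hθ : 0 < θ) (hu : Continuous u)
    (hu' : Continuous u') :
    Continuous (waveRight α θ u u') ∧ Continuous (waveLeft α θ u u') := by
  have hφ : Continuous (phase α θ) :=
    continuous_iff_continuousAt.2 fun x => (hasDerivAt_phase hα hθ x).continuousAt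
  have hc := continuous_spd hα hθ
  have hb : Continuous (amp α θ) := continuous_amp hα hθ
  have hbne : ∀ x, (2 * amp α θ x : ℂ) ≠ 0 := fun x =>
    mul_ne_zero two_ne_zero (by exact_mod_cast (amp_pos hθ x).ne')
  exact ⟨Continuous.div (by fun_prop) (by fun_prop) hbne,
    Continuous.div (by fun_prop) (by fun_prop) hbne⟩

lemma amp_mul_deriv_amp {α θ : ℝ} (hθ : 0 < θ) (x : ℝ) :
    amp α θ x * deriv (fun y => amp α θ y) x = spd α θ x * coupling α θ x := by
  have := (amp_pos (α := α) hθ x).ne'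
  rw [coupling, ← amp_sq hθ]
  field_simp

/-- expression of `R` in terms of `R_{x₀}` up to `O(θ²)`. -/
theorem stmt11 (α x₀ : ℝ) (hα : 0 < α) (hx₀ : 0 < x₀) :
    ∃ θ₂ > (0:ℝ), ∃ C > (0:ℝ), ∀ θ : ℝ, 0 < θ → θ < θ₂ →
      Mtail α θ x₀ < 2 ∧
      ∀ S : ℝ → ℂ, IsVolterraSol α θ x₀ S →
        ∀ u u' : ℝ → ℂ,
          (∀ x : ℝ, HasDerivAt u (u' x) x) →
          (∀ x : ℝ, HasDerivAt u' (-((spd α θ x : ℂ))⁻¹ ^ 2 * u x) x) →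
          (∀ x ∈ Ici x₀, u x = S x * vminus α θ x) →
          ∀ A B : ℂ,
            (∀ x : ℝ, x ≤ 0 →
              u x = B * Complex.exp (-Complex.I * (x : ℂ)) +
                A * Complex.exp (Complex.I * (x : ℂ))) →
            B ≠ 0 ∧
              ‖A / B - Rx α θ x₀ S -
                  (2 * Complex.I)⁻¹ *
                    ((amp α θ x₀ * deriv (fun y => amp α θ y) x₀ : ℝ) : ℂ) *
                    Complex.exp (-2 * Complex.I * (phase α θ x₀ : ℂ)) -
                  ∫ y in (0:ℝ)..x₀,
                    ((deriv (fun z => amp α θ z) y / amp α θ y : ℝ) : ℂ) *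
                      Complex.exp (-2 * Complex.I * (phase α θ y : ℂ))‖ ≤
                C * θ ^ 2 := by
  obtain ⟨θ₁, hθ₁, C₁, hC₁, hR⟩ := exists_norm_Rx_le hα hx₀
  set C₂ : ℝ := α / 4 * x₀ ^ (α - 1) with hC₂
  set C₃ : ℝ := x₀ ^ α / 4 with hC₃
  have hC₂0 : 0 < C₂ := by positivity
  have hC₃0 : 0 < C₃ := by positivity
  set K : ℝ := C₁ + C₂ + C₃ with hK
  have hK0 : 0 < K := by positivity
  refine ⟨min θ₁ (1 / (8 * K)), lt_min hθ₁ (by positivity), 37 * K ^ 2, by positivity,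
    fun θ hθ hθlt => ?_⟩
  obtain ⟨hM, hMt, hRS⟩ := hR θ hθ (hθlt.trans_le (min_le_left _ _))
  refine ⟨by linarith, fun S hS u u' hu hu' huS A B hAB => ?_⟩
  have hδ : K * θ ≤ 1 / 8 := by
    have := (hθlt.trans_le (min_le_right _ _)).le
    rw [le_div_iff₀ (by positivity)] at this
    linarith
  have hKθ : K * θ = C₁ * θ + C₂ * θ + C₃ * θ := by rw [hK]; ring
  have h1 : 0 < C₁ * θ := by positivity
  have h2 : 0 < C₂ * θ := by positivity
  have h3 : 0 < C₃ * θ := by positivity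
  obtain ⟨hpx, hqx, hSx⟩ := waves_match hα hθ hx₀ hM hS (hu x₀) huS
  obtain ⟨hp0, hq0⟩ := waves_zero (θ := θ) hα (hu 0) hAB
  have hRle := hRS S hS
  have hS2 := hS.norm_le_two hM hMt x₀ self_mem_Ici
  obtain ⟨hr, hrle⟩ := intervalIntegrable_coupling hα hθ hx₀
  rw [← hC₃] at hrle
  set κ : ℂ := (2 * Complex.I)⁻¹ * (spd α θ x₀ * coupling α θ x₀) with hκ
  have hκle : ‖κ‖ ≤ C₂ * θ / 2 := by
    have hs := spd_le_one (α := α) hθ x₀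
    have hs0 := (spd_pos (α := α) hθ x₀).le
    rw [hκ, norm_mul, norm_inv_two_mul_I, norm_mul, Complex.norm_real, Complex.norm_real,
      Real.norm_eq_abs, Real.norm_eq_abs, abs_of_nonneg hs0]
    have := mul_le_mul hs (abs_coupling_le hα hθ hx₀) (abs_nonneg _) zero_le_one
    rw [hC₂]
    linarith
  have hexp : ∀ x, ‖Complex.exp (2 * Complex.I * (phase α θ x : ℂ))‖ = 1 := fun x => by
    simpa using norm_exp_neg_two_mul_I (-phase α θ x)
  have hκS : ‖κ * S x₀‖ ≤ C₂ * θ := by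
    rw [norm_mul]
    have := mul_le_mul hκle hS2 (norm_nonneg _) (by positivity)
    linarith
  have hcont := continuous_waves hα hθ (continuous_iff_continuousAt.2 fun x => (hu x).continuousAt)
    (continuous_iff_continuousAt.2 fun x => (hu' x).continuousAt)
  have hφ : Continuous (phase α θ) :=
    continuous_iff_continuousAt.2 fun x => (hasDerivAt_phase hα hθ x).continuousAt
  obtain ⟨hne, hest⟩ := coupled_system_estimate hx₀ hδ hcont.1.continuousOn hcont.2.continuousOn
    (e := fun x => Complex.exp (-2 * Complex.I * (phase α θ x : ℂ)))
    (e' := fun x => Complex.exp (2 * Complex.I * (phase α θ x : ℂ)))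
    (by fun_prop) (by fun_prop) (fun x => norm_exp_neg_two_mul_I _) hexp
    (fun x hx => (hasDerivAt_waves hα hθ hx.1 (hu x) (hu' x)).1)
    (fun x hx => (hasDerivAt_waves hα hθ hx.1 (hu x) (hu' x)).2) hr (by linarith)
    (by
      rw [hpx, sub_sub_cancel_left, norm_neg, mul_left_comm, norm_mul, hexp, one_mul]
      linarith)
    (by
      rw [hqx]
      exact (norm_add_le _ _).trans (by linarith))
  rw [hp0] at hne
  refine ⟨hne, ?_⟩
  rw [hp0, hq0, hqx] at hest
  have hκR : ‖κ * Rx α θ x₀ S‖ ≤ (K * θ) ^ 2 := by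
    rw [norm_mul, sq]
    exact mul_le_mul (by linarith) (by linarith) (norm_nonneg _) (by positivity)
  rw [amp_mul_deriv_amp hθ, Complex.ofReal_mul, ← hκ]
  calc _ = ‖(A / B - (Rx α θ x₀ S + κ * S x₀) - ∫ x in (0 : ℝ)..x₀, (coupling α θ x : ℂ) *
          Complex.exp (-2 * Complex.I * (phase α θ x : ℂ))) + κ * Rx α θ x₀ S‖ := by
        rw [hSx]
        simp only [coupling]
        ring_nf
    _ ≤ 36 * (K * θ) ^ 2 + (K * θ) ^ 2 := (norm_add_le _ _).trans (add_le_add hest hκR)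
    _ = 37 * K ^ 2 * θ ^ 2 := by ring
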